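/- (Hyperbolic Segment Condition) Let X be a G-tree and let e and f be edges such that the segment [e,f] spanned by e and f equals the segment [∂₀e, ∂₀f]. Given γ_e ∈ G_{∂₀e} − G_e and γ_f ∈ G_{∂₀f} − G_f, the product γ_e γ_f is hyperbolic and its axis contains [e,f]. -/

import Mathlib

universe u

/-- A `G`-tree: a simplicial tree together with an action of `G` by graph
automorphisms without inversions. -/
structure GTree (G : Type u) [Group G] : Type (u + 1) where
  V : Type u
  graph : SimpleGraph V
  isTree : graph.IsTree
  smul : G → V → V
  smul_one : ∀ x, smul 1 x = x
  smul_mul : ∀ γ δ x, smul (γ * δ) x = smul γ (smul δ x)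
  smul_adj : ∀ (γ : G) ⦃x y : V⦄, graph.Adj x y → graph.Adj (smul γ x) (smul γ y)
  no_inversions : ∀ (γ : G) (x y : V), graph.Adj x y → ¬(smul γ x = y ∧ smul γ y = x)

namespace GTree

variable {G : Type u} [Group G]

/-- Oriented edges of a `G`-tree. -/
def Edge (X : GTree G) : Type u := { p : X.V × X.V // X.graph.Adj p.1 p.2 }

/-- Initial vertex `∂₀ e` of an oriented edge. -/
def d0 {X : GTree G} (e : X.Edge) : X.V := e.1.1

/-- Terminal vertex `∂₁ e` of an oriented edge. -/
def d1 {X : GTree G} (e : X.Edge) : X.V := e.1.2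

/-- The underlying geometric (unoriented) edge. -/
def esym {X : GTree G} (e : X.Edge) : Sym2 X.V := s(e.1.1, e.1.2)

/-- Action of `G` on oriented edges. -/
def edgeSmul {X : GTree G} (γ : G) (e : X.Edge) : X.Edge :=
  ⟨(X.smul γ e.1.1, X.smul γ e.1.2), X.smul_adj γ e.2⟩

/-- Vertex stabilizer `G_x`. -/
def stab (X : GTree G) (x : X.V) : Subgroup G where
  carrier := { γ | X.smul γ x = x }
  one_mem' := X.smul_one x
  mul_mem' := by
    intro a b ha hb
    simp only [Set.mem_setOf_eq] at *
    rw [X.smul_mul, hb, ha]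
  inv_mem' := by
    intro a ha
    simp only [Set.mem_setOf_eq] at *
    conv_lhs => rw [← ha]
    rw [← X.smul_mul, inv_mul_cancel, X.smul_one]

/-- Edge stabilizer `G_e`: the elements fixing both endpoints (since the action
is without inversions, these are exactly the elements fixing the edge). -/
def edgeStab (X : GTree G) (e : X.Edge) : Subgroup G :=
  X.stab (d0 e) ⊓ X.stab (d1 e)

/-- An element of `G` is elliptic if it fixes a vertex. -/
def Elliptic (X : GTree G) (γ : G) : Prop := ∃ x, X.smul γ x = x

/-- A subgroup of `G` is elliptic if it fixes a vertex. -/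
def FixesVertex (X : GTree G) (H : Subgroup G) : Prop := ∃ x, ∀ γ ∈ H, X.smul γ x = x

/-- Two `G`-trees have the same elliptic subgroups. -/
def SameEllipticSubgroups (X Y : GTree G) : Prop :=
  ∀ H : Subgroup G, X.FixesVertex H ↔ Y.FixesVertex H

/-- The length function `ℓ_X(γ)`: the minimal vertex displacement. -/
noncomputable def transLen (X : GTree G) (γ : G) : ℕ :=
  sInf (Set.range fun x => X.graph.dist x (X.smul γ x))

/-- Cocompact: the quotient graph `G\X` is finite, i.e. there are finitely
many orbits of vertices and of edges. -/
def Cocompact (X : GTree G) : Prop :=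
  Finite (Quot fun x y : X.V => ∃ γ, X.smul γ x = y) ∧
    Finite (Quot fun e f : X.Edge => ∃ γ, edgeSmul γ e = f)

/-- Reduced: whenever `G_e = G_{∂₀ e}`, the endpoints of `e` are in the same
`G`-orbit. -/
def Reduced (X : GTree G) : Prop :=
  ∀ e : X.Edge, X.edgeStab e = X.stab (d0 e) → ∃ γ, X.smul γ (d0 e) = d1 e

/-- A nonempty `G`-invariant subtree (a nonempty invariant set of vertices that
is connected in the induced graph). -/
def IsInvariantSubtree (X : GTree G) (S : Set X.V) : Prop :=
  S.Nonempty ∧ (∀ γ, ∀ x ∈ S, X.smul γ x ∈ S) ∧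
    ∀ x ∈ S, ∀ y ∈ S, ∃ p : X.graph.Walk x y, ∀ v ∈ p.support, v ∈ S

/-- Minimal: there is no proper nonempty invariant subtree. -/
def Minimal (X : GTree G) : Prop :=
  ∀ S : Set X.V, X.IsInvariantSubtree S → S = Set.univ

/-- Strongly slide-free: minimal, and for all edges `e`, `f` with
`∂₀ e = ∂₀ f`, the inclusion `G_e ⊆ G_f` implies `f ∈ G e`. -/
def StronglySlideFree (X : GTree G) : Prop :=
  X.Minimal ∧ ∀ e f : X.Edge, d0 e = d0 f → X.edgeStab e ≤ X.edgeStab f →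
    ∃ γ, edgeSmul γ e = f

/-- Proper: `G_e ⊊ G_{∂₀ e}` for every edge `e`. -/
def Proper (X : GTree G) : Prop := ∀ e : X.Edge, X.edgeStab e < X.stab (d0 e)

/-- Locally finite: every vertex has finite valence. -/
def LocallyFinite (X : GTree G) : Prop := ∀ x : X.V, (X.graph.neighborSet x).Finite

/-- `φ` is an isomorphism of `G`-trees: an equivariant graph isomorphism. -/
def IsGIso (X Y : GTree G) (φ : X.V → Y.V) : Prop :=
  Function.Bijective φ ∧ (∀ x y, X.graph.Adj x y ↔ Y.graph.Adj (φ x) (φ y)) ∧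
    ∀ γ x, φ (X.smul γ x) = Y.smul γ (φ x)

/-- `φ : X → Y` is the collapse move performed at (the orbit of) the edge `e`:
`G_e = G_{∂₀ e}`, the endpoints of `e` lie in different `G`-orbits, and `Y` is
the equivariant quotient of `X` identifying `∂₀(γ e)` with `∂₁(γ e)` for all
`γ ∈ G`. -/
def IsCollapse (X Y : GTree G) (φ : X.V → Y.V) (e : X.Edge) : Prop :=
  X.edgeStab e = X.stab (d0 e) ∧
  (∀ γ : G, X.smul γ (d0 e) ≠ d1 e) ∧
  Function.Surjective φ ∧
  (∀ γ x, φ (X.smul γ x) = Y.smul γ (φ x)) ∧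
  (∀ u v : X.V, φ u = φ v ↔
    Relation.EqvGen (fun a b => ∃ γ : G, a = X.smul γ (d0 e) ∧ b = X.smul γ (d1 e)) u v) ∧
  (∀ a b : Y.V, a ≠ b → (Y.graph.Adj a b ↔ ∃ u v, X.graph.Adj u v ∧ φ u = a ∧ φ v = b))

/-- `Y` is obtained from `X` by a collapse move. -/
def Collapse (X Y : GTree G) : Prop := ∃ (φ : X.V → Y.V) (e : X.Edge), IsCollapse X Y φ e

/-- Elementary deformation: a finite composition of collapse moves and their
inverses (expansion moves). -/
def ElemDeformation : GTree G → GTree G → Prop := Relation.EqvGen Collapse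

end GTree

namespace SimpleGraph

variable {V : Type*} {H : SimpleGraph V}

theorem IsTree.length_eq_dist_of_isPath (hH : H.IsTree) {u v : V} {p : H.Walk u v}
    (hp : p.IsPath) : p.length = H.dist u v := by
  obtain ⟨q, hq, hlen⟩ := hH.connected.exists_path_of_dist u v
  rw [← hlen, (hH.existsUnique_path u v).unique hp hq]

/-- In a forest, two paths whose concatenation does not backtrack concatenate to a path. -/
theorem IsAcyclic.isPath_append (hH : H.IsAcyclic) {x a b w : V} {q : H.Walk x a}
    {p : H.Walk a b} (hq : q.IsPath) (hp : p.IsPath) (hwp : s(a, w) ∈ p.edges)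
    (hwq : s(a, w) ∉ q.edges) : (q.append p).IsPath := by
  rw [hH.isPath_iff_isChain, Walk.edges_append, List.isChain_append]
  refine ⟨(hH.isPath_iff_isChain q).1 hq, (hH.isPath_iff_isChain p).1 hp, ?_⟩
  rintro y hy z hz rfl
  have hw : w = p.snd := hp.eq_snd_of_mem_edges hwp
  cases p with
  | nil => simp at hwp
  | cons h p' =>
    obtain rfl : s(a, _) = y := by simpa using hz
    rw [Walk.snd_cons] at hw
    exact hwq (hw ▸ List.mem_of_mem_getLast? hy)

/-- In a tree, if the paths from the endpoints of a nontrivial segment `p` to `x` and `y` leave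
`p` immediately, then the geodesic from `x` to `y` runs through `p`. -/
theorem IsTree.dist_eq_of_notMem_edges (hH : H.IsTree) {x y a b w z : V} {p : H.Walk a b}
    {q : H.Walk a x} {r : H.Walk b y} (hp : p.IsPath) (hq : q.IsPath) (hr : r.IsPath)
    (hwp : s(a, w) ∈ p.edges) (hzp : s(b, z) ∈ p.edges) (hwq : s(a, w) ∉ q.edges)
    (hzr : s(b, z) ∉ r.edges) :
    H.dist x y = H.dist a x + H.dist a b + H.dist b y := by
  have hpr : (p.append r).IsPath := by
    rw [← Walk.isPath_reverse_iff, Walk.reverse_append]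
    exact hH.isAcyclic.isPath_append hr.reverse hp.reverse (by simpa using hzp) (by simpa using hzr)
  have hall : (q.reverse.append (p.append r)).IsPath :=
    hH.isAcyclic.isPath_append (w := w) hq.reverse hpr (by simp [Walk.edges_append, hwp])
      (by simpa using hwq)
  have hlen := hH.length_eq_dist_of_isPath hall
  simp only [Walk.length_append, Walk.length_reverse] at hlen
  rw [hH.length_eq_dist_of_isPath hp, hH.length_eq_dist_of_isPath hq,
    hH.length_eq_dist_of_isPath hr] at hlen
  omega

theorem IsTree.dist_add_dist_of_mem_support (hH : H.IsTree) {a b v : V} {p : H.Walk a b}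
    (hp : p.IsPath) (hv : v ∈ p.support) : H.dist a v + H.dist v b = H.dist a b := by
  classical
  rw [← hH.length_eq_dist_of_isPath hp, ← hH.length_eq_dist_of_isPath (hp.takeUntil hv),
    ← hH.length_eq_dist_of_isPath (hp.dropUntil hv), ← Walk.length_append, Walk.take_spec]

end SimpleGraph

namespace GTree

variable {G : Type u} [Group G] (X : GTree G)

theorem smul_inv_smul (γ : G) (x : X.V) : X.smul γ (X.smul γ⁻¹ x) = x := by
  rw [← X.smul_mul, mul_inv_cancel, X.smul_one]

theorem inv_smul_smul (γ : G) (x : X.V) : X.smul γ⁻¹ (X.smul γ x) = x := by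
  rw [← X.smul_mul, inv_mul_cancel, X.smul_one]

theorem smul_injective (γ : G) : Function.Injective (X.smul γ) :=
  Function.LeftInverse.injective (X.inv_smul_smul γ)

/-- An element of `G` as an endomorphism of the underlying graph. -/
def smulHom (γ : G) : X.graph →g X.graph := ⟨X.smul γ, fun h => X.smul_adj γ h⟩

theorem dist_smul_le (γ : G) (x y : X.V) :
    X.graph.dist (X.smul γ x) (X.smul γ y) ≤ X.graph.dist x y := by
  obtain ⟨q, hq⟩ := X.isTree.connected.exists_walk_length_eq_dist x y
  rw [← hq, ← SimpleGraph.Walk.length_map (X.smulHom γ) q]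
  exact SimpleGraph.dist_le _

theorem dist_smul_smul (γ : G) (x y : X.V) :
    X.graph.dist (X.smul γ x) (X.smul γ y) = X.graph.dist x y := by
  refine le_antisymm (X.dist_smul_le γ x y) ?_
  simpa only [inv_smul_smul] using X.dist_smul_le γ⁻¹ (X.smul γ x) (X.smul γ y)

theorem dist_smul_mul (γ δ : G) (x : X.V) :
    X.graph.dist x (X.smul (γ * δ) x) = X.graph.dist (X.smul γ⁻¹ x) (X.smul δ x) := by
  rw [← X.dist_smul_smul γ (X.smul γ⁻¹ x), smul_inv_smul, smul_mul]

/-- An element fixing `a` but not its neighbour `w` moves every vertex of the branch at `a`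
through `w` out of that branch. -/
theorem exists_isPath_smul_notMem_edges {γ : G} {a w x : X.V} {q : X.graph.Walk a x}
    (hq : q.IsPath) (hwq : s(a, w) ∈ q.edges) (ha : X.smul γ a = a) (hw : X.smul γ w ≠ w) :
    ∃ r : X.graph.Walk a (X.smul γ x), r.IsPath ∧ s(a, w) ∉ r.edges := by
  have hφ : X.smulHom γ a = a := ha
  have hφx : X.smulHom γ x = X.smul γ x := rfl
  have hmap : (q.map (X.smulHom γ)).IsPath := hq.map (X.smul_injective γ)
  refine ⟨(q.map (X.smulHom γ)).copy hφ hφx, (SimpleGraph.Walk.isPath_copy _ _ _).2 hmap, ?_⟩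
  rw [SimpleGraph.Walk.edges_copy]
  intro hmem
  have hmem' : s(X.smulHom γ a, w) ∈ (q.map (X.smulHom γ)).edges := by
    convert hmem using 2
  have h₁ := hmap.eq_snd_of_mem_edges hmem'
  have h₂ := hq.eq_snd_of_mem_edges hwq
  rw [SimpleGraph.Walk.snd, SimpleGraph.Walk.getVert_map, ← SimpleGraph.Walk.snd, ← h₂] at h₁
  exact hw h₁.symm

/-- If `γ` and `δ` fix the endpoints `a` and `b` of a nontrivial segment and move its extremal
edges, then `γ * δ` displaces every vertex by at least twice the length of the segment. -/
theorem two_mul_dist_le_dist_smul_mul {γ δ : G} {a b w z : X.V} {p : X.graph.Walk a b}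
    (hp : p.IsPath) (hwp : s(a, w) ∈ p.edges) (hzp : s(b, z) ∈ p.edges)
    (ha : X.smul γ a = a) (hw : X.smul γ w ≠ w) (hb : X.smul δ b = b) (hz : X.smul δ z ≠ z)
    (x : X.V) : 2 * X.graph.dist a b ≤ X.graph.dist x (X.smul (γ * δ) x) := by
  have hT := X.isTree
  have ha' : X.smul γ⁻¹ a = a := (X.stab a).inv_mem ha
  have hw' : X.smul γ⁻¹ w ≠ w := fun h => hw (by simpa [h] using X.smul_inv_smul γ w)
  have hdx : X.graph.dist a (X.smul γ⁻¹ x) = X.graph.dist a x := by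
    rw [← X.dist_smul_smul γ⁻¹ a x, ha']
  have hdy : X.graph.dist b (X.smul δ x) = X.graph.dist b x := by
    rw [← X.dist_smul_smul δ b x, hb]
  have hab : 0 < X.graph.dist a b := by
    rw [← hT.length_eq_dist_of_isPath hp, ← SimpleGraph.Walk.length_edges]
    exact List.length_pos_of_mem hwp
  rw [X.dist_smul_mul]
  obtain ⟨q, hq, -⟩ := hT.existsUnique_path a x
  obtain ⟨r, hr, -⟩ := hT.existsUnique_path b x
  have fromA : ∀ {y : X.V} {q' : X.graph.Walk a y}, q'.IsPath → s(a, w) ∉ q'.edges →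
      X.graph.dist b y = X.graph.dist a y + X.graph.dist a b := fun {y q'} h h' => by
    simpa [SimpleGraph.dist_comm] using
      hT.dist_eq_of_notMem_edges hp h SimpleGraph.Walk.IsPath.nil hwp hzp h' (by simp)
  have fromB : ∀ {y : X.V} {r' : X.graph.Walk b y}, r'.IsPath → s(b, z) ∉ r'.edges →
      X.graph.dist a y = X.graph.dist a b + X.graph.dist b y := fun {y r'} h h' => by
    simpa using
      hT.dist_eq_of_notMem_edges hp SimpleGraph.Walk.IsPath.nil h hwp hzp (by simp) h'
  have triA := hT.connected.dist_triangle (u := a) (v := X.smul γ⁻¹ x) (w := X.smul δ x)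
  have triB := hT.connected.dist_triangle (u := b) (v := X.smul δ x) (w := X.smul γ⁻¹ x)
  rw [X.graph.dist_comm (u := X.smul δ x)] at triB
  have tri := hT.connected.dist_triangle (u := a) (v := x) (w := b)
  rw [X.graph.dist_comm (u := x)] at tri
  by_cases hA : s(a, w) ∈ q.edges
  · obtain ⟨q', hq', hwq'⟩ := X.exists_isPath_smul_notMem_edges hq hA ha' hw'
    by_cases hB : s(b, z) ∈ r.edges
    · obtain ⟨r', hr', hzr'⟩ := X.exists_isPath_smul_notMem_edges hr hB hb hz
      have := hT.dist_eq_of_notMem_edges hp hq' hr' hwp hzp hwq' hzr'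
      omega
    · have := fromB hr hB
      have := fromA hq' hwq'
      omega
  · have := fromA hq hA
    by_cases hB : s(b, z) ∈ r.edges
    · obtain ⟨r', hr', hzr'⟩ := X.exists_isPath_smul_notMem_edges hr hB hb hz
      have := fromB hr' hzr'
      omega
    · have := fromB hr hB
      omega

theorem dist_smul_mul_le {γ δ : G} {a b v : X.V} {p : X.graph.Walk a b} (hp : p.IsPath)
    (ha : X.smul γ a = a) (hb : X.smul δ b = b) (hv : v ∈ p.support) :
    X.graph.dist v (X.smul (γ * δ) v) ≤ 2 * X.graph.dist a b := by
  have hc := X.isTree.connected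
  have ha' : X.smul γ⁻¹ a = a := (X.stab a).inv_mem ha
  have hdx : X.graph.dist (X.smul γ⁻¹ v) a = X.graph.dist a v := by
    rw [SimpleGraph.dist_comm, ← X.dist_smul_smul γ⁻¹ a v, ha']
  have hdy : X.graph.dist b (X.smul δ v) = X.graph.dist v b := by
    rw [SimpleGraph.dist_comm, ← X.dist_smul_smul δ v b, hb]
  have h₁ := hc.dist_triangle (u := X.smul γ⁻¹ v) (v := a) (w := X.smul δ v)
  have h₂ := hc.dist_triangle (u := a) (v := b) (w := X.smul δ v)
  have h₃ := X.isTree.dist_add_dist_of_mem_support hp hv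
  rw [X.dist_smul_mul]
  omega

end GTree

open GTree in
/-- Lemma 2.7 (Hyperbolic Segment Condition): let `e` and `f` be edges of a
`G`-tree `X` such that `[e, f] = [∂₀ e, ∂₀ f]` (i.e. the path `p` from `∂₀ e`
to `∂₀ f` contains both edges `e` and `f`).  Given `γₑ ∈ G_{∂₀ e} − G_e` and
`γ_f ∈ G_{∂₀ f} − G_f`, the product `γₑ γ_f` is hyperbolic and its axis
contains `[e, f]` (every vertex of `p` realizes the translation length). -/
theorem hyperbolic_segment_condition {G : Type u} [Group G] (X : GTree G)
    (e f : X.Edge) (p : X.graph.Walk (d0 e) (d0 f)) (hp : p.IsPath)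
    (he : esym e ∈ p.edges) (hf : esym f ∈ p.edges)
    (γe γf : G)
    (h1 : γe ∈ X.stab (d0 e)) (h2 : γe ∉ X.edgeStab e)
    (h3 : γf ∈ X.stab (d0 f)) (h4 : γf ∉ X.edgeStab f) :
    ¬ X.Elliptic (γe * γf) ∧
      ∀ v ∈ p.support, X.graph.dist v (X.smul (γe * γf) v) = X.transLen (γe * γf) := by
  have hw : X.smul γe (d1 e) ≠ d1 e := fun h => h2 ⟨h1, h⟩
  have hz : X.smul γf (d1 f) ≠ d1 f := fun h => h4 ⟨h3, h⟩
  have hlow := X.two_mul_dist_le_dist_smul_mul hp he hf h1 hw h3 hz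
  have hpos : 0 < X.graph.dist (d0 e) (d0 f) := by
    rw [← X.isTree.length_eq_dist_of_isPath hp, ← SimpleGraph.Walk.length_edges]
    exact List.length_pos_of_mem he
  refine ⟨?_, fun v hv => ?_⟩
  · rintro ⟨x, hx⟩
    have := hlow x
    rw [hx, SimpleGraph.dist_self] at this
    omega
  · refine le_antisymm (le_csInf (Set.range_nonempty_iff_nonempty.2 ⟨v⟩) ?_)
      (Nat.sInf_le ⟨v, rfl⟩)
    rintro _ ⟨x, rfl⟩
    exact (X.dist_smul_mul_le hp h1 h3 hv).trans (hlow x)
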